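/- Let G be a simple graph on n vertices with m edges and let c = (c_1,…,c_s) be a composition of n. Set a(c) = e_2/n^{(2)} + 3·e_3/n^{(3)} and b(c) = (4/n^{(4)})·( e_2² − (n−1)·e_2 − 3·e_3 ), where e_k = E_k(c_1,…,c_s). Then the variance of L(G) (equivalently of M(G), since L(G) + M(G) = m) under a uniformly random c-coloring equals (a(c) − b(c))·Σ_2(G) + m²·( b(c) − 4·[e_2/n^{(2)}]² ) + m·( 2·e_2/n^{(2)} − 2·a(c) + b(c) ), where Σ_2(G) is the sum of the squares of the vertex degrees. -/

import Mathlib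

open Finset MeasureTheory Filter
open scoped Classical

/-- The finset of `c`-colorings of the vertex set `Fin n` with `s` colors:
maps `f : Fin n → Fin s` whose color class of color `i` has exactly `c i` elements. -/
noncomputable def colorings (n s : ℕ) (c : Fin s → ℕ) : Finset (Fin n → Fin s) :=
  Finset.univ.filter fun f => ∀ i, (Finset.univ.filter fun v => f v = i).card = c i

/-- Probability of an event under the uniform measure on the set of `c`-colorings. -/
noncomputable def colProb (n s : ℕ) (c : Fin s → ℕ) (E : (Fin n → Fin s) → Prop) : ℝ :=
  (((colorings n s c).filter fun f => E f).card : ℝ) / ((colorings n s c).card : ℝ)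

/-- Expectation of a real statistic under the uniform measure on `c`-colorings. -/
noncomputable def colExp (n s : ℕ) (c : Fin s → ℕ) (Y : (Fin n → Fin s) → ℝ) : ℝ :=
  (∑ f ∈ colorings n s c, Y f) / ((colorings n s c).card : ℝ)

/-- Variance of a real statistic under the uniform measure on `c`-colorings. -/
noncomputable def colVar (n s : ℕ) (c : Fin s → ℕ) (Y : (Fin n → Fin s) → ℝ) : ℝ :=
  colExp n s c fun f => (Y f - colExp n s c Y) ^ 2

/-- The number of edges of `G`. -/
noncomputable def edgeCount {n : ℕ} (G : SimpleGraph (Fin n)) : ℕ := G.edgeSet.ncard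

/-- `M_i(G)(f)`: the number of edges of `G` whose two endpoints both receive color `i`
under the coloring `f`. -/
noncomputable def monoEdges {n s : ℕ} (G : SimpleGraph (Fin n)) (i : Fin s)
    (f : Fin n → Fin s) : ℕ :=
  {e ∈ G.edgeSet | ∀ v ∈ e, f v = i}.ncard

/-- `M(G)(f) = ∑ i, M_i(G)(f)`: the total number of monochromatic edges. -/
noncomputable def monoTotal {n s : ℕ} (G : SimpleGraph (Fin n)) (f : Fin n → Fin s) : ℕ :=
  ∑ i, monoEdges G i f

/-- `L(G)(f) = m - M(G)(f)`: the number of bichromatic edges. -/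
noncomputable def biEdges {n s : ℕ} (G : SimpleGraph (Fin n)) (f : Fin n → Fin s) : ℝ :=
  (edgeCount G : ℝ) - (monoTotal G f : ℝ)

/-- `Σ₂(G)`: the sum of the squares of the degrees of `G`. -/
noncomputable def sigma2 {n : ℕ} (G : SimpleGraph (Fin n)) : ℕ :=
  ∑ v, ((G.neighborSet v).ncard) ^ 2

/-- `ζ(G) = √(Σ₂(G)) / m`. -/
noncomputable def zeta {n : ℕ} (G : SimpleGraph (Fin n)) : ℝ :=
  Real.sqrt (sigma2 G) / (edgeCount G : ℝ)


theorem vl_sum_fib {n s : ℕ} {c : Fin s → ℕ} {f : Fin n → Fin s} (hf : f ∈ colorings n s c)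
    (φ : Fin s → ℝ) : ∑ v, φ (f v) = ∑ i, (c i : ℝ) * φ i := by
  simp only [colorings, Finset.mem_filter, Finset.mem_univ, true_and] at hf
  rw [← Finset.sum_fiberwise' Finset.univ f φ]
  refine Finset.sum_congr rfl fun i _ => ?_
  rw [Finset.sum_const, nsmul_eq_mul, ← hf i]

theorem vl_nonempty (n s : ℕ) (c : Fin s → ℕ) (hsum : ∑ i, c i = n) :
    ((colorings n s c).card : ℝ) ≠ 0 := by
  subst hsum
  have : (colorings (∑ i, c i) s c).Nonempty := by
    refine ⟨fun v => (finSigmaFinEquiv.symm v).1, ?_⟩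
    simp only [colorings, Finset.mem_filter, Finset.mem_univ, true_and]
    intro i
    have : (Finset.univ.filter fun v : Fin (∑ i, c i) => (finSigmaFinEquiv.symm v).1 = i)
        = Finset.univ.image (fun k : Fin (c i) => finSigmaFinEquiv ⟨i, k⟩) := by
      ext v
      simp only [Finset.mem_filter, Finset.mem_univ, true_and, Finset.mem_image]
      constructor
      · rintro rfl
        exact ⟨(finSigmaFinEquiv.symm v).2, by simp⟩
      · rintro ⟨k, rfl⟩
        simp
    rw [this, Finset.card_image_of_injective]
    · simp
    · intro a b h
      simpa using h
  exact_mod_cast this.card_pos.ne'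

theorem vl_sym (n s : ℕ) (c : Fin s → ℕ) (σ : Equiv.Perm (Fin n)) (Y : (Fin n → Fin s) → ℝ) :
    colExp n s c (fun f => Y (f ∘ σ)) = colExp n s c Y := by
  unfold colExp
  congr 1
  have key : ∀ (τ : Equiv.Perm (Fin n)) (f : Fin n → Fin s), f ∈ colorings n s c →
      f ∘ τ ∈ colorings n s c := by
    intro τ f hf
    simp only [colorings, Finset.mem_filter, Finset.mem_univ, true_and] at hf ⊢
    intro i
    rw [← hf i]
    refine Finset.card_bij (fun v _ => τ v) (by simp) (by simp) ?_
    intro b hb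
    exact ⟨τ.symm b, by simpa using hb, by simp⟩
  refine Finset.sum_bij' (fun f _ => f ∘ σ) (fun f _ => f ∘ σ.symm) (fun f hf => key σ f hf)
    (fun f hf => key σ.symm f hf) ?_ ?_ ?_
  · intro f _; ext; simp
  · intro f _; ext; simp
  · intro f _; rfl

theorem vl_exp_sum {ι : Type*} (n s : ℕ) (c : Fin s → ℕ) (S : Finset ι)
    (Y : ι → (Fin n → Fin s) → ℝ) :
    colExp n s c (fun f => ∑ i ∈ S, Y i f) = ∑ i ∈ S, colExp n s c (Y i) := by
  unfold colExp
  rw [Finset.sum_comm, Finset.sum_div]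

theorem vl_exp_mul (n s : ℕ) (c : Fin s → ℕ) (a : ℝ) (Y : (Fin n → Fin s) → ℝ) :
    colExp n s c (fun f => a * Y f) = a * colExp n s c Y := by
  unfold colExp
  rw [← Finset.mul_sum, mul_div_assoc]

theorem vl_exp_const (n s : ℕ) (c : Fin s → ℕ) (hsum : ∑ i, c i = n) (a : ℝ)
    (Y : (Fin n → Fin s) → ℝ) (h : ∀ f ∈ colorings n s c, Y f = a) :
    colExp n s c Y = a := by
  unfold colExp
  rw [Finset.sum_congr rfl h, Finset.sum_const, nsmul_eq_mul,
    mul_div_cancel_left₀ _ (vl_nonempty n s c hsum)]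

theorem vl_var (n s : ℕ) (c : Fin s → ℕ) (hsum : ∑ i, c i = n) (Y : (Fin n → Fin s) → ℝ) :
    colVar n s c Y = colExp n s c (fun f => (Y f) ^ 2) - (colExp n s c Y) ^ 2 := by
  have hN := vl_nonempty n s c hsum
  unfold colVar
  set μ := colExp n s c Y with hμ
  have h1 : ∑ f ∈ colorings n s c, Y f = μ * (colorings n s c).card := by
    rw [hμ]; unfold colExp; field_simp
  unfold colExp
  have : ∀ f, (Y f - μ) ^ 2 = Y f ^ 2 - 2 * μ * Y f + μ ^ 2 := fun f => by ring
  simp only [this, Finset.sum_add_distrib, Finset.sum_sub_distrib, ← Finset.mul_sum, h1,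
    Finset.sum_const, nsmul_eq_mul]
  field_simp
  ring

/-- indicator that the pair is bichromatic -/
noncomputable def vlX {n s : ℕ} (u v : Fin n) (f : Fin n → Fin s) : ℝ :=
  if f u = f v then 0 else 1

theorem vlX_self {n s : ℕ} (u : Fin n) (f : Fin n → Fin s) : vlX u u f = 0 := by simp [vlX]
theorem vlX_comm {n s : ℕ} (u v : Fin n) (f : Fin n → Fin s) : vlX u v f = vlX v u f := by
  simp [vlX, eq_comm]
theorem vlX_sq {n s : ℕ} (u v : Fin n) (f : Fin n → Fin s) :
    vlX u v f * vlX u v f = vlX u v f := by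
  unfold vlX; split_ifs <;> simp

theorem vl_row {n s : ℕ} {c : Fin s → ℕ} {f : Fin n → Fin s} (hf : f ∈ colorings n s c)
    (u : Fin n) : ∑ v, vlX u v f = n - c (f u) := by
  have hf' := hf
  simp only [colorings, Finset.mem_filter, Finset.mem_univ, true_and] at hf'
  have : ∀ v, vlX u v f = 1 - if f v = f u then 1 else 0 := by
    intro v; unfold vlX; by_cases h : f v = f u
    · simp [h]
    · simp [h, Ne.symm h]
  simp only [this, Finset.sum_sub_distrib]
  rw [Finset.sum_boole, hf' (f u)]
  simp

theorem vl_newton {s : ℕ} (x : Fin s → ℝ) :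
    2 * (∑ A ∈ Finset.univ.powersetCard 2, ∏ i ∈ A, x i) = (∑ i, x i) ^ 2 - ∑ i, x i ^ 2 ∧
    6 * (∑ A ∈ Finset.univ.powersetCard 3, ∏ i ∈ A, x i)
      = (∑ i, x i) ^ 3 - 3 * (∑ i, x i) * (∑ i, x i ^ 2) + 2 * ∑ i, x i ^ 3 := by
  have E : ∀ k, MvPolynomial.aeval x (MvPolynomial.esymm (Fin s) ℝ k)
      = ∑ A ∈ Finset.univ.powersetCard k, ∏ i ∈ A, x i := by
    intro k; simp [MvPolynomial.esymm, map_sum, map_prod]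
  have P : ∀ k, MvPolynomial.aeval x (MvPolynomial.psum (Fin s) ℝ k) = ∑ i, x i ^ k := by
    intro k; simp [MvPolynomial.psum, map_sum]
  have E0 := E 0
  have h1 := congrArg (MvPolynomial.aeval x) (MvPolynomial.mul_esymm_eq_sum (Fin s) ℝ 1)
  have h2 := congrArg (MvPolynomial.aeval x) (MvPolynomial.mul_esymm_eq_sum (Fin s) ℝ 2)
  have h3 := congrArg (MvPolynomial.aeval x) (MvPolynomial.mul_esymm_eq_sum (Fin s) ℝ 3)
  have a1 : (antidiagonal 1).filter (fun a : ℕ × ℕ => a.1 < 1) = {(0, 1)} := by decide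
  have a2 : (antidiagonal 2).filter (fun a : ℕ × ℕ => a.1 < 2) = {(0, 2), (1, 1)} := by decide
  have a3 : (antidiagonal 3).filter (fun a : ℕ × ℕ => a.1 < 3) = {(0, 3), (1, 2), (2, 1)} := by
    decide
  have d1 : ((0, 2) : ℕ × ℕ) ∉ ({(1, 1)} : Finset (ℕ × ℕ)) := by decide
  have d2 : ((0, 3) : ℕ × ℕ) ∉ ({(1, 2), (2, 1)} : Finset (ℕ × ℕ)) := by decide
  have d3 : ((1, 2) : ℕ × ℕ) ∉ ({(2, 1)} : Finset (ℕ × ℕ)) := by decide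
  rw [a1, Finset.sum_singleton] at h1
  rw [a2, Finset.sum_insert d1, Finset.sum_singleton] at h2
  rw [a3, Finset.sum_insert d2, Finset.sum_insert d3, Finset.sum_singleton] at h3
  simp only [map_mul, map_add, map_pow, map_neg, map_one, map_natCast, E, P] at h1 h2 h3
  simp only [Finset.powersetCard_zero, Finset.sum_singleton, Finset.prod_empty] at h1 h2 h3
  generalize (∑ A ∈ Finset.univ.powersetCard 1, ∏ i ∈ A, x i) = e1 at *
  generalize (∑ A ∈ Finset.univ.powersetCard 2, ∏ i ∈ A, x i) = e2 at *
  generalize (∑ A ∈ Finset.univ.powersetCard 3, ∏ i ∈ A, x i) = e3 at *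
  simp only [pow_one] at h1 h2 h3
  generalize (∑ i, x i) = q1 at *
  generalize (∑ i, x i ^ 2) = q2 at *
  generalize (∑ i, x i ^ 3) = q3 at *
  push_cast at h1 h2 h3
  have h1' : e1 = q1 := by linarith
  subst h1'
  have h2' : e2 = (e1 ^ 2 - q2) / 2 := by linarith
  subst h2'
  constructor
  · ring
  · linarith

theorem vl_expand {n : ℕ} (A : Fin n → Fin n → ℝ) (hs : ∀ u v, A u v = A v u)
    (h0 : ∀ u, A u u = 0) (g : Fin n → Fin n → Fin n → Fin n → ℝ) (p2 p3 p4 : ℝ)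
    (hg : ∀ u v w x, u ≠ v → w ≠ x → g u v w x = p4
      + (p3 - p4) * ((if u = w then 1 else 0) + (if u = x then 1 else 0)
        + (if v = w then 1 else 0) + (if v = x then 1 else 0))
      + (p2 - 2 * p3 + p4) * ((if u = w then 1 else 0) * (if v = x then 1 else 0)
        + (if u = x then 1 else 0) * (if v = w then 1 else 0))) :
    ∑ u, ∑ v, ∑ w, ∑ x, A u v * A w x * g u v w x
      = p4 * (∑ u, ∑ v, A u v) ^ 2 + 4 * (p3 - p4) * (∑ u, (∑ v, A u v) ^ 2)
        + 2 * (p2 - 2 * p3 + p4) * ∑ u, ∑ v, A u v ^ 2 := by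
  have e : ∀ u v w x, A u v * A w x * g u v w x = p4 * (A u v * A w x)
      + (p3 - p4) * (if u = w then A u v * A w x else 0)
      + (p3 - p4) * (if u = x then A u v * A w x else 0)
      + (p3 - p4) * (if v = w then A u v * A w x else 0)
      + (p3 - p4) * (if v = x then A u v * A w x else 0)
      + (p2 - 2 * p3 + p4) * (if u = w then (if v = x then A u v * A w x else 0) else 0)
      + (p2 - 2 * p3 + p4) * (if u = x then (if v = w then A u v * A w x else 0) else 0) := by
    intro u v w x
    by_cases h1 : u = v
    · subst h1; simp [h0]
    by_cases h2 : w = x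
    · subst h2; simp [h0]
    rw [hg u v w x h1 h2]
    split_ifs <;> ring
  have t1 : ∑ u, ∑ v, ∑ w, ∑ x, (if u = w then A u v * A w x else 0)
      = ∑ u, (∑ v, A u v) ^ 2 := by
    refine Finset.sum_congr rfl fun u _ => ?_
    rw [sq, Finset.sum_mul]
    simp only [Finset.mul_sum]
    refine Finset.sum_congr rfl fun v _ => ?_
    rw [Finset.sum_comm]
    simp
  have t2 : ∑ u, ∑ v, ∑ w, ∑ x, (if u = x then A u v * A w x else 0)
      = ∑ u, (∑ v, A u v) ^ 2 := by
    refine Finset.sum_congr rfl fun u _ => ?_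
    rw [sq, Finset.sum_mul]
    simp only [Finset.mul_sum]
    refine Finset.sum_congr rfl fun v _ => ?_
    simp [hs _ u]
  have t3 : ∑ u, ∑ v, ∑ w, ∑ x, (if v = w then A u v * A w x else 0)
      = ∑ u, (∑ v, A u v) ^ 2 := by
    rw [Finset.sum_comm, ← t1]
    refine Finset.sum_congr rfl fun u _ => Finset.sum_congr rfl fun v _ => ?_
    simp only [hs v u]
  have t4 : ∑ u, ∑ v, ∑ w, ∑ x, (if v = x then A u v * A w x else 0)
      = ∑ u, (∑ v, A u v) ^ 2 := by
    rw [Finset.sum_comm, ← t2]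
    refine Finset.sum_congr rfl fun u _ => Finset.sum_congr rfl fun v _ => ?_
    simp only [hs v u]
  have t5 : ∑ u, ∑ v, ∑ w, ∑ x, (if u = w then (if v = x then A u v * A w x else 0) else 0)
      = ∑ u, ∑ v, A u v ^ 2 := by
    refine Finset.sum_congr rfl fun u _ => Finset.sum_congr rfl fun v _ => ?_
    rw [Finset.sum_comm]
    simp [sq]
  have t6 : ∑ u, ∑ v, ∑ w, ∑ x, (if u = x then (if v = w then A u v * A w x else 0) else 0)
      = ∑ u, ∑ v, A u v ^ 2 := by
    refine Finset.sum_congr rfl fun u _ => Finset.sum_congr rfl fun v _ => ?_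
    simp [sq, hs v u]
  simp only [e, Finset.sum_add_distrib, ← Finset.mul_sum]
  rw [t1, t2, t3, t4, t5, t6]
  simp only [← Finset.sum_mul]
  ring

theorem vl_edges {n : ℕ} (H : SimpleGraph (Fin n)) :
    2 * (H.edgeSet.ncard : ℝ) = ∑ u, ∑ v, (if H.Adj u v then (1 : ℝ) else 0) := by
  have h := H.sum_degrees_eq_twice_card_edges
  have h2 : H.edgeSet.ncard = H.edgeFinset.card := by
    rw [← SimpleGraph.coe_edgeFinset, Set.ncard_coe_finset]
  rw [h2]
  have : (2 * (H.edgeFinset.card : ℝ)) = ((∑ v, H.degree v : ℕ) : ℝ) := by rw [h]; push_cast; ring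
  rw [this]
  push_cast
  refine Finset.sum_congr rfl fun u _ => ?_
  rw [Finset.sum_boole, ← SimpleGraph.card_neighborFinset_eq_degree,
    SimpleGraph.neighborFinset_eq_filter]

theorem vl_mono {n s : ℕ} (G : SimpleGraph (Fin n)) (i : Fin s) (f : Fin n → Fin s) :
    2 * (monoEdges G i f : ℝ)
      = ∑ u, ∑ v, (if G.Adj u v ∧ f u = i ∧ f v = i then (1 : ℝ) else 0) := by
  let H : SimpleGraph (Fin n) :=
    { Adj := fun u v => G.Adj u v ∧ f u = i ∧ f v = i
      symm := ⟨fun u v h => ⟨h.1.symm, h.2.2, h.2.1⟩⟩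
      loopless := ⟨fun u h => G.loopless.irrefl u h.1⟩ }
  have : {e ∈ G.edgeSet | ∀ v ∈ e, f v = i} = H.edgeSet := by
    ext e
    induction e with
    | _ u v => simp [H]
  unfold monoEdges
  rw [this, vl_edges]
  refine Finset.sum_congr rfl fun u _ => Finset.sum_congr rfl fun v _ => ?_
  by_cases h : G.Adj u v ∧ f u = i ∧ f v = i
  · rw [if_pos h]; exact (if_pos h).symm
  · rw [if_neg h]; exact (if_neg h).symm

theorem vl_bi {n s : ℕ} (G : SimpleGraph (Fin n)) (f : Fin n → Fin s) :
    biEdges G f = 1 / 2 * ∑ u, ∑ v, (if G.Adj u v then (1 : ℝ) else 0) * vlX u v f := by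
  have h1 := vl_edges G
  have h2 : 2 * (monoTotal G f : ℝ)
      = ∑ u, ∑ v, (if G.Adj u v ∧ f u = f v then (1 : ℝ) else 0) := by
    unfold monoTotal
    push_cast
    rw [Finset.mul_sum]
    simp only [vl_mono]
    rw [Finset.sum_comm]
    refine Finset.sum_congr rfl fun u _ => ?_
    rw [Finset.sum_comm]
    refine Finset.sum_congr rfl fun v _ => ?_
    by_cases h : G.Adj u v
    · by_cases h' : f u = f v
      · simp [h, h']
      · simp only [h, h', true_and, and_false, if_false]
        refine Finset.sum_eq_zero fun i _ => ?_
        rw [if_neg]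
        rintro ⟨rfl, h2⟩
        exact h' h2.symm
    · simp [h]
  have h3 : ∑ u, ∑ v, (if G.Adj u v then (1 : ℝ) else 0) * vlX u v f
      = (∑ u, ∑ v, (if G.Adj u v then (1 : ℝ) else 0))
        - ∑ u, ∑ v, (if G.Adj u v ∧ f u = f v then (1 : ℝ) else 0) := by
    simp only [← Finset.sum_sub_distrib]
    refine Finset.sum_congr rfl fun u _ => Finset.sum_congr rfl fun v _ => ?_
    unfold vlX
    by_cases h : G.Adj u v <;> by_cases h' : f u = f v <;> simp [h, h']
  unfold biEdges edgeCount
  rw [h3, ← h1, ← h2]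
  ring

theorem vl_inv2 (n s : ℕ) (c : Fin s → ℕ) {u v u' v' : Fin n} (h : u ≠ v) (h' : u' ≠ v') :
    colExp n s c (vlX u v) = colExp n s c (vlX u' v') := by
  obtain ⟨σ, hσ⟩ := Equiv.Perm.exists_extending_pair ![u, v] ![u', v']
    (by intro i j; fin_cases i <;> fin_cases j <;> simp [h, h.symm])
    (by intro i j; fin_cases i <;> fin_cases j <;> simp [h', h'.symm])
  have h0 : σ u = u' := hσ 0
  have h1 : σ v = v' := hσ 1
  rw [← vl_sym n s c σ (vlX u v), ← h0, ← h1]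
  rfl

theorem vl_inv3 (n s : ℕ) (c : Fin s → ℕ) {u v w u' v' w' : Fin n} (h1 : u ≠ v) (h2 : u ≠ w)
    (h3 : v ≠ w) (h1' : u' ≠ v') (h2' : u' ≠ w') (h3' : v' ≠ w') :
    colExp n s c (fun f => vlX u v f * vlX u w f)
      = colExp n s c (fun f => vlX u' v' f * vlX u' w' f) := by
  obtain ⟨σ, hσ⟩ := Equiv.Perm.exists_extending_pair ![u, v, w] ![u', v', w']
    (by intro i j; fin_cases i <;> fin_cases j <;>
          simp [h1, h1.symm, h2, h2.symm, h3, h3.symm])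
    (by intro i j; fin_cases i <;> fin_cases j <;>
          simp [h1', h1'.symm, h2', h2'.symm, h3', h3'.symm])
  have e0 : σ u = u' := hσ 0
  have e1 : σ v = v' := hσ 1
  have e2 : σ w = w' := hσ 2
  rw [← vl_sym n s c σ (fun f => vlX u v f * vlX u w f), ← e0, ← e1, ← e2]
  rfl

theorem vl_inv4 (n s : ℕ) (c : Fin s → ℕ) {u v w x u' v' w' x' : Fin n} (h1 : u ≠ v)
    (h2 : u ≠ w) (h3 : u ≠ x) (h4 : v ≠ w) (h5 : v ≠ x) (h6 : w ≠ x) (h1' : u' ≠ v')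
    (h2' : u' ≠ w') (h3' : u' ≠ x') (h4' : v' ≠ w') (h5' : v' ≠ x') (h6' : w' ≠ x') :
    colExp n s c (fun f => vlX u v f * vlX w x f)
      = colExp n s c (fun f => vlX u' v' f * vlX w' x' f) := by
  obtain ⟨σ, hσ⟩ := Equiv.Perm.exists_extending_pair ![u, v, w, x] ![u', v', w', x']
    (by intro i j; fin_cases i <;> fin_cases j <;>
          simp [h1, h1.symm, h2, h2.symm, h3, h3.symm, h4, h4.symm, h5, h5.symm, h6, h6.symm])
    (by intro i j; fin_cases i <;> fin_cases j <;>
          simp [h1', h1'.symm, h2', h2'.symm, h3', h3'.symm, h4', h4'.symm, h5', h5'.symm,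
            h6', h6'.symm])
  have e0 : σ u = u' := hσ 0
  have e1 : σ v = v' := hσ 1
  have e2 : σ w = w' := hσ 2
  have e3 : σ x = x' := hσ 3
  rw [← vl_sym n s c σ (fun f => vlX u v f * vlX w x f), ← e0, ← e1, ← e2, ← e3]
  rfl

theorem vl_sum_ne {n : ℕ} (u : Fin n) (a : ℝ) :
    ∑ v, (if u = v then 0 else a) = ((n : ℝ) - 1) * a := by
  have : ∀ v, (if u = v then 0 else a) = a - if u = v then a else 0 := by
    intro v; split_ifs <;> simp
  simp only [this, Finset.sum_sub_distrib]
  simp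
  ring

theorem vl_tot {n s : ℕ} {c : Fin s → ℕ} (hsum : ∑ i, c i = n) {f : Fin n → Fin s}
    (hf : f ∈ colorings n s c) :
    ∑ u, ∑ v, vlX u v f = (n : ℝ) ^ 2 - ∑ i, (c i : ℝ) ^ 2 := by
  have hsum' : ∑ i, (c i : ℝ) = n := by exact_mod_cast hsum
  simp only [vl_row hf]
  rw [vl_sum_fib hf (fun i => (n : ℝ) - c i)]
  simp only [mul_sub, Finset.sum_sub_distrib, ← Finset.sum_mul, hsum', sq]

theorem vl_tot3 {n s : ℕ} {c : Fin s → ℕ} (hsum : ∑ i, c i = n) {f : Fin n → Fin s}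
    (hf : f ∈ colorings n s c) :
    ∑ u, ∑ v, ∑ w, vlX u v f * vlX u w f
      = (n : ℝ) ^ 3 - 2 * n * (∑ i, (c i : ℝ) ^ 2) + ∑ i, (c i : ℝ) ^ 3 := by
  have hsum' : ∑ i, (c i : ℝ) = n := by exact_mod_cast hsum
  simp only [← Finset.mul_sum, ← Finset.sum_mul, vl_row hf]
  rw [vl_sum_fib hf (fun i => ((n : ℝ) - c i) * (n - c i))]
  have : ∀ i, (c i : ℝ) * (((n : ℝ) - c i) * (n - c i))
      = n ^ 2 * c i - 2 * n * (c i : ℝ) ^ 2 + (c i : ℝ) ^ 3 := fun i => by ring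
  simp only [this, Finset.sum_add_distrib, Finset.sum_sub_distrib, ← Finset.mul_sum, hsum']
  ring

theorem vl_p2 (n s : ℕ) (c : Fin s → ℕ) (hsum : ∑ i, c i = n) {u v : Fin n} (h : u ≠ v) :
    (n : ℝ) * (n - 1) * colExp n s c (vlX u v) = (n : ℝ) ^ 2 - ∑ i, (c i : ℝ) ^ 2 := by
  rw [← vl_exp_const n s c hsum _ _ (fun f hf => vl_tot hsum hf)]
  simp only [vl_exp_sum]
  have : ∀ u' v' : Fin n, colExp n s c (vlX u' v')
      = if u' = v' then 0 else colExp n s c (vlX u v) := by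
    intro u' v'
    split_ifs with h'
    · subst h'
      exact vl_exp_const n s c hsum _ _ (fun f _ => vlX_self _ _)
    · exact vl_inv2 n s c h' h
  have e : ∀ u' v' : Fin n, colExp n s c (fun f => vlX u' v' f)
      = if u' = v' then 0 else colExp n s c (vlX u v) := this
  generalize colExp n s c (vlX u v) = p at *
  simp only [e, vl_sum_ne]
  simp
  ring

theorem vl_p3 (n s : ℕ) (c : Fin s → ℕ) (hsum : ∑ i, c i = n) {u v w : Fin n} (h1 : u ≠ v)
    (h2 : u ≠ w) (h3 : v ≠ w) :
    (n : ℝ) * (n - 1) * colExp n s c (vlX u v)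
      + (n : ℝ) * (n - 1) * (n - 2) * colExp n s c (fun f => vlX u v f * vlX u w f)
      = (n : ℝ) ^ 3 - 2 * n * (∑ i, (c i : ℝ) ^ 2) + ∑ i, (c i : ℝ) ^ 3 := by
  rw [← vl_exp_const n s c hsum _ _ (fun f hf => vl_tot3 hsum hf)]
  simp only [vl_exp_sum]
  set p2 := colExp n s c (vlX u v) with hp2
  set p3 := colExp n s c (fun f => vlX u v f * vlX u w f) with hp3
  have e : ∀ u' v' w' : Fin n, colExp n s c (fun f => vlX u' v' f * vlX u' w' f)
      = if u' = v' then 0 else ((if u' = w' then 0 else p3)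
        + if v' = w' then p2 - p3 else 0) := by
    intro u' v' w'
    by_cases g1 : u' = v'
    · subst g1
      rw [if_pos rfl]
      exact vl_exp_const n s c hsum _ _ (fun f _ => by rw [vlX_self, zero_mul])
    rw [if_neg g1]
    by_cases g2 : u' = w'
    · subst g2
      rw [if_pos rfl, if_neg (Ne.symm g1), add_zero]
      exact vl_exp_const n s c hsum _ _ (fun f _ => by rw [vlX_self, mul_zero])
    rw [if_neg g2]
    by_cases g3 : v' = w'
    · subst g3
      rw [if_pos rfl]
      simp only [vlX_sq]
      have := vl_inv2 n s c g1 h1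
      rw [hp2, ← this]
      simp
    rw [if_neg g3, add_zero, hp3]
    exact vl_inv3 n s c g1 g2 g3 h1 h2 h3
  simp only [e]
  have e2 : ∀ u' v' : Fin n, ∑ w', (if u' = v' then (0 : ℝ) else ((if u' = w' then 0 else p3)
        + if v' = w' then p2 - p3 else 0))
        = if u' = v' then 0 else (((n : ℝ) - 1) * p3 + (p2 - p3)) := by
    intro u' v'
    split_ifs with h
    · simp
    · rw [Finset.sum_add_distrib, vl_sum_ne]; simp
  simp only [e2, vl_sum_ne]
  simp
  ring

theorem vl_g (n s : ℕ) (c : Fin s → ℕ) (p2 p3 p4 : ℝ)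
    (H2 : ∀ u v : Fin n, u ≠ v → colExp n s c (vlX u v) = p2)
    (H3 : ∀ u v w : Fin n, u ≠ v → u ≠ w → v ≠ w →
      colExp n s c (fun f => vlX u v f * vlX u w f) = p3)
    (H4 : ∀ u v w x : Fin n, u ≠ v → u ≠ w → u ≠ x → v ≠ w → v ≠ x → w ≠ x →
      colExp n s c (fun f => vlX u v f * vlX w x f) = p4) (u v w x : Fin n) (h : u ≠ v)
    (h' : w ≠ x) :
    colExp n s c (fun f => vlX u v f * vlX w x f) = p4
      + (p3 - p4) * ((if u = w then 1 else 0) + (if u = x then 1 else 0)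
        + (if v = w then 1 else 0) + (if v = x then 1 else 0))
      + (p2 - 2 * p3 + p4) * ((if u = w then 1 else 0) * (if v = x then 1 else 0)
        + (if u = x then 1 else 0) * (if v = w then 1 else 0)) := by
  by_cases g1 : u = w
  · subst g1
    by_cases g2 : v = x
    · subst g2
      simp only [vlX_sq]
      have := H2 u v h
      simp only [h, h.symm, if_true, if_false]
      refine Eq.trans this ?_
      ring
    · rw [H3 u v x h h' g2]
      simp only [h, h', h.symm, g2, if_true, if_false]
      ring
  by_cases g2 : u = x
  · subst g2
    simp only [vlX_comm w u]
    by_cases g3 : v = w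
    · subst g3
      simp only [vlX_sq]
      simp only [h, h.symm, if_true, if_false]
      refine Eq.trans (H2 u v h) ?_
      ring
    · rw [H3 u v w h g1 g3]
      simp only [h.symm, g1, g3, if_true, if_false]
      ring
  by_cases g3 : v = w
  · subst g3
    simp only [vlX_comm u v]
    rw [H3 v u x h.symm h' g2]
    simp only [h, h', g2, if_true, if_false]
    ring
  by_cases g4 : v = x
  · subst g4
    simp only [vlX_comm u v, vlX_comm w v]
    rw [H3 v u w h.symm g3 g1]
    simp only [h, g1, g3, if_true, if_false]
    ring
  rw [H4 u v w x h g1 g2 g3 g4 h']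
  simp only [g1, g2, g3, g4, if_false]
  ring

theorem vl_sqexp (n s : ℕ) (c : Fin s → ℕ) (A : Fin n → Fin n → ℝ) :
    colExp n s c (fun f => (∑ u, ∑ v, A u v * vlX u v f) ^ 2)
      = ∑ u, ∑ v, ∑ w, ∑ x, A u v * A w x * colExp n s c (fun f => vlX u v f * vlX w x f) := by
  have : ∀ f : Fin n → Fin s, (∑ u, ∑ v, A u v * vlX u v f) ^ 2
      = ∑ u, ∑ v, ∑ w, ∑ x, A u v * A w x * (vlX u v f * vlX w x f) := by
    intro f
    rw [sq, Finset.sum_mul]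
    refine Finset.sum_congr rfl fun u _ => ?_
    rw [Finset.sum_mul]
    refine Finset.sum_congr rfl fun v _ => ?_
    simp only [Finset.mul_sum]
    refine Finset.sum_congr rfl fun w _ => Finset.sum_congr rfl fun x _ => ?_
    ring
  simp only [this, vl_exp_sum, vl_exp_mul]

theorem vl_p4 (n s : ℕ) (c : Fin s → ℕ) (hsum : ∑ i, c i = n) (p2 p3 : ℝ)
    (H2 : ∀ u v : Fin n, u ≠ v → colExp n s c (vlX u v) = p2)
    (H3 : ∀ u v w : Fin n, u ≠ v → u ≠ w → v ≠ w →
      colExp n s c (fun f => vlX u v f * vlX u w f) = p3)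
    {u v w x : Fin n} (h1 : u ≠ v)
    (h2 : u ≠ w) (h3 : u ≠ x) (h4 : v ≠ w) (h5 : v ≠ x) (h6 : w ≠ x) (p4 : ℝ)
    (hp4 : p4 = colExp n s c (fun f => vlX u v f * vlX w x f)) :
    p4 * (n * (n - 1)) ^ 2 + 4 * (p3 - p4) * (n * (n - 1) ^ 2)
      + 2 * (p2 - 2 * p3 + p4) * (n * (n - 1)) = ((n : ℝ) ^ 2 - ∑ i, (c i : ℝ) ^ 2) ^ 2 := by
  have key := vl_expand (fun u v : Fin n => if u = v then (0 : ℝ) else 1)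
    (by intro u v; simp [eq_comm]) (by simp) _ p2 p3 p4
    (vl_g n s c p2 p3 p4 H2 H3 (by
      intro u' v' w' x' a1 a2 a3 a4 a5 a6
      rw [hp4]
      exact vl_inv4 n s c a1 a2 a3 a4 a5 a6 h1 h2 h3 h4 h5 h6))
  rw [← vl_sqexp] at key
  rw [vl_exp_const n s c hsum (((n : ℝ) ^ 2 - ∑ i, (c i : ℝ) ^ 2) ^ 2)] at key
  · have i1 : ∀ u v : Fin n, (if u = v then (0 : ℝ) else 1) ^ 2 = if u = v then 0 else 1 := by
      intro u v; split_ifs <;> simp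
    simp only [i1, vl_sum_ne] at key
    rw [key]
    simp
    ring
  · intro f hf
    rw [← vl_tot hsum hf]
    congr 1
    refine Finset.sum_congr rfl fun u _ => Finset.sum_congr rfl fun v _ => ?_
    split_ifs with h
    · subst h; simp [vlX_self]
    · simp

/-- With `a(c) = e₂/n^{(2)} + 3e₃/n^{(3)}` and
`b(c) = (4/n^{(4)})(e₂² - (n-1)e₂ - 3e₃)`, the variance of `L(G)` (equivalently of `M(G)`)
under a uniformly random `c`-coloring equals
`(a(c)-b(c)) Σ₂(G) + m² (b(c) - 4[e₂/n^{(2)}]²) + m (2e₂/n^{(2)} - 2a(c) + b(c))`. -/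
theorem stmt9 (n s : ℕ) (hs2 : 2 ≤ s) (hsn : s ≤ n)
    (c : Fin s → ℕ) (hpos : ∀ i, 0 < c i) (hsum : ∑ i, c i = n)
    (G : SimpleGraph (Fin n)) (m : ℕ) (hm : m = edgeCount G)
    (e2 e3 : ℝ)
    (he2 : e2 = ∑ A ∈ Finset.univ.powersetCard 2, ∏ i ∈ A, (c i : ℝ))
    (he3 : e3 = ∑ A ∈ Finset.univ.powersetCard 3, ∏ i ∈ A, (c i : ℝ))
    (aC bC : ℝ)
    (haC : aC = e2 / (n.descFactorial 2 : ℝ) + 3 * e3 / (n.descFactorial 3 : ℝ))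
    (hbC : bC = 4 / (n.descFactorial 4 : ℝ) * (e2 ^ 2 - ((n : ℝ) - 1) * e2 - 3 * e3)) :
    colVar n s c (fun f => biEdges G f)
      = (aC - bC) * (sigma2 G : ℝ)
        + (m : ℝ) ^ 2 * (bC - 4 * (e2 / (n.descFactorial 2 : ℝ)) ^ 2)
        + (m : ℝ) * (2 * e2 / (n.descFactorial 2 : ℝ) - 2 * aC + bC)
      ∧ colVar n s c (fun f => (monoTotal G f : ℝ))
        = colVar n s c (fun f => biEdges G f) := by
  have hN := vl_nonempty n s c hsum
  have hn2 : 2 ≤ n := hs2.trans hsn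
  have hsum' : ∑ i, (c i : ℝ) = n := by exact_mod_cast hsum
  obtain ⟨N2, N3⟩ := vl_newton (fun i => (c i : ℝ))
  rw [← he2, hsum'] at N2
  rw [← he3, hsum'] at N3
  have hn2r : (2 : ℝ) ≤ n := by exact_mod_cast hn2
  have d2 : (n.descFactorial 2 : ℝ) = n * (n - 1) := by
    rw [Nat.cast_descFactorial_two]
  have d3 : (n.descFactorial 3 : ℝ) = n * (n - 1) * (n - 2) := by
    rw [Nat.descFactorial_succ, Nat.cast_mul, d2, Nat.cast_sub hn2]; push_cast; ring
  have H2 : ∀ u v : Fin n, u ≠ v → colExp n s c (vlX u v) = 2 * e2 / (n.descFactorial 2 : ℝ) := by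
    intro u v h
    have := vl_p2 n s c hsum h
    have h1 : (n : ℝ) - 1 ≠ 0 := by linarith
    have h0 : (n : ℝ) ≠ 0 := by linarith
    rw [d2, eq_div_iff (mul_ne_zero h0 h1)]
    linarith
  have H3 : ∀ u v w : Fin n, u ≠ v → u ≠ w → v ≠ w →
      colExp n s c (fun f => vlX u v f * vlX u w f) = aC := by
    intro u v w h1 h2 h3
    have := vl_p3 n s c hsum h1 h2 h3
    rw [vl_p2 n s c hsum h1] at this
    have hn3 : 3 ≤ n := by
      have := Finset.card_le_univ ({u, v, w} : Finset (Fin n))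
      rw [Finset.card_eq_three.mpr ⟨u, v, w, h1, h2, h3, rfl⟩] at this
      simpa using this
    have hn3r : (3 : ℝ) ≤ n := by exact_mod_cast hn3
    have h0 : (n : ℝ) ≠ 0 := by linarith
    have h1 : (n : ℝ) - 1 ≠ 0 := by linarith
    have h2 : (n : ℝ) - 2 ≠ 0 := by linarith
    rw [haC, d3, d2]
    have : (n : ℝ) * (n - 1) * (n - 2) * colExp n s c (fun f => vlX u v f * vlX u w f)
        = (n - 2) * e2 + 3 * e3 := by
      linear_combination this - (n : ℝ) / 2 * N2 - N3 / 2 + N2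
    rw [eq_comm, ← mul_right_inj' (mul_ne_zero (mul_ne_zero h0 h1) h2), this]
    field_simp
  have H4 : ∀ u v w x : Fin n, u ≠ v → u ≠ w → u ≠ x → v ≠ w → v ≠ x → w ≠ x →
      colExp n s c (fun f => vlX u v f * vlX w x f) = bC := by
    intro u v w x h1 h2 h3 h4 h5 h6
    have := vl_p4 n s c hsum _ _ H2 H3 h1 h2 h3 h4 h5 h6 _ rfl
    have hn4 : 4 ≤ n := by
      have := Finset.card_le_univ ({u, v, w, x} : Finset (Fin n))
      rw [Finset.card_insert_of_notMem (by simp [h1, h2, h3]),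
        Finset.card_eq_three.mpr ⟨v, w, x, h4, h5, h6, rfl⟩] at this
      simpa using this
    have hn4r : (4 : ℝ) ≤ n := by exact_mod_cast hn4
    have d4 : (n.descFactorial 4 : ℝ) = n * (n - 1) * (n - 2) * (n - 3) := by
      rw [Nat.descFactorial_succ, Nat.cast_mul, d3, Nat.cast_sub (by omega)]; push_cast; ring
    have k0 : (n : ℝ) ≠ 0 := by linarith
    have k1 : (n : ℝ) - 1 ≠ 0 := by linarith
    have k2 : (n : ℝ) - 2 ≠ 0 := by linarith
    have k3 : (n : ℝ) - 3 ≠ 0 := by linarith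
    have A1 : n * (n - 1) * (2 * e2 / (n.descFactorial 2 : ℝ)) = 2 * e2 := by
      rw [d2]; field_simp
    have A2 : n * (n - 1) * (n - 2) * aC = (n - 2) * e2 + 3 * e3 := by
      rw [haC, d2, d3]; field_simp
    generalize colExp n s c (fun f => vlX u v f * vlX w x f) = p4 at *
    generalize 2 * e2 / (n.descFactorial 2 : ℝ) = p2 at *
    rw [← N2] at this
    have B : n * (n - 1) * (n - 2) * (n - 3) * p4
        = 4 * (e2 ^ 2 - ((n : ℝ) - 1) * e2 - 3 * e3) := by
      linear_combination this - 4 * A2 - 2 * A1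
    rw [hbC, d4, eq_comm, ← mul_right_inj' (mul_ne_zero (mul_ne_zero (mul_ne_zero k0 k1) k2) k3), B]
    field_simp
  have hsymA : ∀ u v : Fin n, (if G.Adj u v then (1 : ℝ) else 0) = if G.Adj v u then 1 else 0 := by
    intro u v; simp [G.adj_comm u v]
  have h0A : ∀ u : Fin n, (if G.Adj u u then (1 : ℝ) else 0) = 0 := by
    intro u; simp
  have key := vl_expand (fun u v : Fin n => if G.Adj u v then (1 : ℝ) else 0) hsymA h0A _ _ _ _
    (vl_g n s c _ aC bC H2 H3 H4)
  rw [← vl_sqexp] at key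
  have hE := vl_edges G
  have hm' : ∑ u, ∑ v, (if G.Adj u v then (1 : ℝ) else 0) = 2 * m := by
    rw [← hE, hm]; rfl
  have hdeg : ∑ u, (∑ v, (if G.Adj u v then (1 : ℝ) else 0)) ^ 2 = sigma2 G := by
    unfold sigma2
    push_cast
    refine Finset.sum_congr rfl fun u _ => ?_
    congr 1
    rw [Finset.sum_boole, ← Set.ncard_coe_finset]
    congr 2
    ext v
    simp
  have hsqA : ∀ u v : Fin n, (if G.Adj u v then (1 : ℝ) else 0) ^ 2
      = if G.Adj u v then (1 : ℝ) else 0 := by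
    intro u v; split_ifs <;> simp
  simp only [hsqA, hm', hdeg] at key
  have hEx : colExp n s c (fun f => biEdges G f) = m * (2 * e2 / (n.descFactorial 2 : ℝ)) := by
    simp only [vl_bi, vl_exp_mul, vl_exp_sum]
    have : ∀ u v : Fin n, (if G.Adj u v then (1 : ℝ) else 0) * colExp n s c (fun f => vlX u v f)
        = (if G.Adj u v then (1 : ℝ) else 0) * (2 * e2 / (n.descFactorial 2 : ℝ)) := by
      intro u v
      by_cases h : G.Adj u v
      · have := H2 u v h.ne
        simp only [h, if_true, one_mul]
        exact this
      · simp [h]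
    simp only [this, ← Finset.sum_mul, hm']
    ring
  have hEx2 : colExp n s c (fun f => (biEdges G f) ^ 2) = 1 / 4 * colExp n s c (fun f =>
      (∑ u, ∑ v, (if G.Adj u v then (1 : ℝ) else 0) * vlX u v f) ^ 2) := by
    rw [← vl_exp_mul]
    congr 1
    ext f
    rw [vl_bi]
    ring
  constructor
  · rw [vl_var n s c hsum, hEx2, hEx, key]
    ring
  · have hmono : colExp n s c (fun f => (monoTotal G f : ℝ))
        = edgeCount G - colExp n s c (fun f => biEdges G f) := by
      unfold colExp biEdges
      rw [Finset.sum_sub_distrib, Finset.sum_const, nsmul_eq_mul]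
      field_simp
      ring
    unfold colVar
    rw [hmono]
    congr 1
    ext f
    unfold biEdges
    ring
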